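/- Let P• be an acyclic complex of projective left R-modules with cycles C_n = ker(P_n → P_{n+1}), and let X be a left R-module. Then the complex Hom_R(P•, X) is acyclic if and only if Ext^1_R(C_n, X) = 0 for all n ∈ Z. -/

import Mathlib

universe u v

/-- A `ℤ`-indexed complex is *acyclic* if it is exact at every degree. -/
def IsAcyclicComplex {R : Type v} [Ring R] (M : ℤ → Type u)
    [∀ n, AddCommGroup (M n)] [∀ n, Module R (M n)]
    (d : ∀ n, M n →ₗ[R] M (n + 1)) : Prop :=
  ∀ n, LinearMap.range (d n) = LinearMap.ker (d (n + 1))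

/-- `Ext¹_R(A, B) = 0`, phrased via the standard characterization: every short exact
sequence `0 → B → E → A → 0` splits. -/
def Ext1Zero (R : Type v) [Ring R] (A B : Type u) [AddCommGroup A] [Module R A]
    [AddCommGroup B] [Module R B] : Prop :=
  ∀ (E : Type u) [AddCommGroup E] [Module R E],
    ∀ (i : B →ₗ[R] E) (p : E →ₗ[R] A),
      Function.Injective i → Function.Surjective p →
        LinearMap.range i = LinearMap.ker p →
          ∃ s : A →ₗ[R] E, p ∘ₗ s = LinearMap.id

/-- Precomposition with a linear map `f : M → N`, as an additive homomorphism
`Hom_R(N, X) →+ Hom_R(M, X)`; this is the result of applying the contravariant functor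
`Hom_R(-, X)`. -/
def precompHom {R : Type v} [Ring R] {M N X : Type u}
    [AddCommGroup M] [Module R M] [AddCommGroup N] [Module R N]
    [AddCommGroup X] [Module R X] (f : M →ₗ[R] N) :
    (N →ₗ[R] X) →+ (M →ₗ[R] X) :=
  AddMonoidHom.mk' (fun φ => φ.comp f) (fun φ ψ => by ext x; simp)

theorem aux_factor {R : Type v} [Ring R] {M A N : Type u}
    [AddCommGroup M] [Module R M] [AddCommGroup A] [Module R A] [AddCommGroup N] [Module R N]
    (q : M →ₗ[R] A) (hq : Function.Surjective q) (f : M →ₗ[R] N)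
    (h : ∀ x, q x = 0 → f x = 0) : ∃ s : A →ₗ[R] N, ∀ x, s (q x) = f x := by
  refine ⟨((LinearMap.ker q).liftQ f (fun x hx => h x hx)).comp
    (q.quotKerEquivOfSurjective hq).symm.toLinearMap, fun x => ?_⟩
  have : (q.quotKerEquivOfSurjective hq).symm (q x) = (LinearMap.ker q).mkQ x := by
    rw [LinearEquiv.symm_apply_eq]; rfl
  rw [LinearMap.comp_apply, LinearEquiv.coe_coe, this]
  rfl

theorem aux_colift {R : Type v} [Ring R] {M X E : Type u}
    [AddCommGroup M] [Module R M] [AddCommGroup X] [Module R X] [AddCommGroup E] [Module R E]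
    (i : X →ₗ[R] E) (hi : Function.Injective i) (f : M →ₗ[R] E)
    (h : ∀ x, f x ∈ LinearMap.range i) : ∃ g : M →ₗ[R] X, ∀ x, i (g x) = f x := by
  refine ⟨(LinearEquiv.ofInjective i hi).symm.toLinearMap.comp
    (f.codRestrict (LinearMap.range i) h), fun x => ?_⟩
  have := (LinearEquiv.ofInjective i hi).apply_symm_apply (f.codRestrict (LinearMap.range i) h x)
  simpa using congrArg Subtype.val this

theorem aux_ext {R : Type v} [Ring R] {M A X : Type u}
    [AddCommGroup M] [Module R M] [AddCommGroup A] [Module R A] [AddCommGroup X] [Module R X]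
    [Module.Projective R M] (q : M →ₗ[R] A) (hq : Function.Surjective q) :
    Ext1Zero R A X ↔
      ∀ f : LinearMap.ker q →ₗ[R] X, ∃ g : M →ₗ[R] X, ∀ k : LinearMap.ker q, g k = f k := by
  constructor
  · intro H f
    let j : LinearMap.ker q →ₗ[R] X × M := f.prod (-(LinearMap.ker q).subtype)
    let S := LinearMap.range j
    let i : X →ₗ[R] (X × M) ⧸ S := S.mkQ.comp (LinearMap.inl R X M)
    let t : M →ₗ[R] (X × M) ⧸ S := S.mkQ.comp (LinearMap.inr R X M)
    let p : (X × M) ⧸ S →ₗ[R] A := S.liftQ (q.comp (LinearMap.snd R X M)) (by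
      rintro _ ⟨k, rfl⟩
      simp [j])
    have hit : ∀ k : LinearMap.ker q, t k = i (f k) := by
      intro k
      symm
      refine (Submodule.Quotient.eq S).2 ⟨k, ?_⟩
      simp [j]
    have hpt : ∀ y, p (t y) = q y := fun y => by simp [p, t]
    have hpi : ∀ x, p (i x) = 0 := fun y => by simp [p, i]
    have hi : Function.Injective i := by
      rw [injective_iff_map_eq_zero]
      intro x hx
      obtain ⟨k, hk⟩ := (Submodule.Quotient.mk_eq_zero S).1 hx
      have h2 : -(k : M) = 0 := congrArg Prod.snd hk
      have h1 : f k = x := congrArg Prod.fst hk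
      have : k = 0 := Subtype.ext (by simpa using h2)
      rw [← h1, this, map_zero]
    have hr : LinearMap.range i = LinearMap.ker p := by
      apply le_antisymm
      · rintro _ ⟨x, rfl⟩
        exact hpi x
      · intro e he
        obtain ⟨⟨x, y⟩, rfl⟩ := S.mkQ_surjective e
        have e1 : S.mkQ (x, y) = i x + t y := by
          simp only [i, t, LinearMap.comp_apply, ← map_add]
          simp
        have hy : q y = 0 := by
          have : p (S.mkQ (x, y)) = 0 := he
          rw [e1, map_add, hpi, hpt, zero_add] at this
          exact this
        rw [e1]
        exact ⟨x + f ⟨y, hy⟩, by rw [map_add, ← hit]⟩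
    obtain ⟨s, hs⟩ := H _ i p hi
      (fun a => by obtain ⟨y, rfl⟩ := hq a; exact ⟨t y, hpt y⟩) hr
    obtain ⟨g, hg⟩ := aux_colift i hi (t - s.comp q) (by
      intro y
      rw [hr, LinearMap.mem_ker]
      have := LinearMap.congr_fun hs (q y)
      simp only [LinearMap.comp_apply, LinearMap.id_apply] at this
      simp [hpt, this])
    refine ⟨g, fun k => hi ?_⟩
    rw [hg, ← hit]
    simp
  · intro H E _ _ i p hi hp hr
    obtain ⟨h, hh⟩ := Module.projective_lifting_property p q hp
    have hh' : ∀ y, p (h y) = q y := fun y => LinearMap.congr_fun hh y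
    obtain ⟨f, hf⟩ := aux_colift i hi (h.comp (LinearMap.ker q).subtype) (by
      intro k
      rw [hr, LinearMap.mem_ker]
      simp [hh'])
    obtain ⟨g, hg⟩ := H f
    have hpi : ∀ x, p (i x) = 0 := fun x => by
      rw [← LinearMap.mem_ker, ← hr]; exact ⟨x, rfl⟩
    obtain ⟨s, hs⟩ := aux_factor q hq (h - i.comp g) (by
      intro x hx
      have h1 := hf ⟨x, hx⟩
      rw [← hg] at h1
      simp at h1
      simp [h1])
    refine ⟨s, LinearMap.ext fun a => ?_⟩
    obtain ⟨y, rfl⟩ := hq a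
    simp [hs, hh', hpi]

theorem aux_step {R : Type v} [Ring R] {A B C D X : Type u}
    [AddCommGroup A] [Module R A] [AddCommGroup B] [Module R B] [AddCommGroup C] [Module R C]
    [AddCommGroup D] [Module R D] [AddCommGroup X] [Module R X]
    (a : A →ₗ[R] B) (b : B →ₗ[R] C) (c : C →ₗ[R] D)
    (hab : LinearMap.range a = LinearMap.ker b) (hbc : LinearMap.range b = LinearMap.ker c) :
    AddMonoidHom.range (precompHom (X := X) b) = AddMonoidHom.ker (precompHom (X := X) a) ↔
      ∀ f : LinearMap.ker c →ₗ[R] X, ∃ g : C →ₗ[R] X, ∀ k : LinearMap.ker c, g k = f k := by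
  have hba : ∀ x, b (a x) = 0 := fun x => by
    rw [← LinearMap.mem_ker, ← hab]; exact ⟨x, rfl⟩
  let q : B →ₗ[R] LinearMap.ker c := b.codRestrict _ (fun x => by rw [← hbc]; exact ⟨x, rfl⟩)
  have hqv : ∀ x, (q x : C) = b x := fun x => rfl
  have hq : Function.Surjective q := by
    rintro ⟨y, hy⟩
    rw [← hbc] at hy
    obtain ⟨x, hx⟩ := hy
    exact ⟨x, Subtype.ext hx⟩
  constructor
  · intro H f
    have : f.comp q ∈ AddMonoidHom.ker (precompHom (X := X) a) := by
      refine LinearMap.ext fun x => ?_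
      have : q (a x) = 0 := Subtype.ext (hba x)
      change f (q (a x)) = 0
      rw [this, map_zero]
    rw [← H] at this
    obtain ⟨g, hg⟩ := this
    refine ⟨g, fun k => ?_⟩
    obtain ⟨x, rfl⟩ := hq k
    exact LinearMap.congr_fun hg x
  · intro H
    apply le_antisymm
    · rintro _ ⟨g, rfl⟩
      refine LinearMap.ext fun x => ?_
      change g (b (a x)) = 0
      rw [hba, map_zero]
    · intro φ hφ
      have hφ' : ∀ x, φ (a x) = 0 := fun x => LinearMap.congr_fun hφ x
      obtain ⟨f, hf⟩ := aux_factor q hq φ (by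
        intro x hx
        have : x ∈ LinearMap.ker b := congrArg Subtype.val hx
        rw [← hab] at this
        obtain ⟨y, rfl⟩ := this
        exact hφ' y)
      obtain ⟨g, hg⟩ := H f
      refine ⟨g, LinearMap.ext fun x => ?_⟩
      change g (b x) = φ x
      rw [← hf, ← hg, hqv]

theorem aux_cycle {R : Type v} [Ring R] {C D E X : Type u}
    [AddCommGroup C] [Module R C] [AddCommGroup D] [Module R D] [AddCommGroup E] [Module R E]
    [AddCommGroup X] [Module R X] [Module.Projective R C]
    (c : C →ₗ[R] D) (e : D →ₗ[R] E) (hce : LinearMap.range c = LinearMap.ker e) :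
    Ext1Zero R (LinearMap.ker e) X ↔
      ∀ f : LinearMap.ker c →ₗ[R] X, ∃ g : C →ₗ[R] X, ∀ k : LinearMap.ker c, g k = f k := by
  rw [← hce]
  have := aux_ext (X := X) c.rangeRestrict c.surjective_rangeRestrict
  rwa [LinearMap.ker_rangeRestrict] at this

/-- Let `P•` be an acyclic complex of projective `R`-modules with cycles
`C n = ker (P n → P (n+1))`, and `X` an `R`-module.  Then the complex `Hom_R(P•, X)` is
acyclic iff `Ext¹(C n, X) = 0` for all `n`. -/
theorem hom_acyclic_iff_ext_vanishes {R : Type v} [Ring R]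
    (P : ℤ → Type u) [∀ n, AddCommGroup (P n)] [∀ n, Module R (P n)]
    [∀ n, Module.Projective R (P n)]
    (d : ∀ n, P n →ₗ[R] P (n + 1))
    (hd2 : ∀ n, (d (n + 1)).comp (d n) = 0)
    (hac : IsAcyclicComplex P d)
    (X : Type u) [AddCommGroup X] [Module R X] :
    (∀ n : ℤ, AddMonoidHom.range (precompHom (X := X) (d (n + 1))) =
        AddMonoidHom.ker (precompHom (X := X) (d n))) ↔
      ∀ n : ℤ, Ext1Zero R ↥(LinearMap.ker (d n)) X := by
  have key : ∀ n : ℤ, AddMonoidHom.range (precompHom (X := X) (d (n + 1))) =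
        AddMonoidHom.ker (precompHom (X := X) (d n)) ↔
        Ext1Zero R ↥(LinearMap.ker (d (n + 1 + 1 + 1))) X := fun n =>
    (aux_step (d n) (d (n + 1)) (d (n + 1 + 1)) (hac n) (hac (n + 1))).trans
      (aux_cycle (d (n + 1 + 1)) (d (n + 1 + 1 + 1)) (hac (n + 1 + 1))).symm
  constructor
  · intro H m
    obtain ⟨n, rfl⟩ : ∃ n : ℤ, m = n + 1 + 1 + 1 := ⟨m - 3, by ring⟩
    exact (key n).1 (H n)
  · intro H n
    exact (key n).2 (H _)
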